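/- For every finite graph G, the tangle number of G is at most 70 times the separation number of G: tn(G) ≤ 70·sn(G). Equivalently, if a ≥ 1 and every subgraph of G has a balanced separation of order at most a, then G contains no tangle of order 70a+1. -/

import Mathlib

open Finset

universe u

variable {V : Type u} [Fintype V] [DecidableEq V]

/-- `(A, B)` is a separation of the subgraph `H` of `G`: `A ∪ B` is the vertex set of `H`
and no edge of `H` has one end in `A \ B` and the other in `B \ A`.
Its order is `(A ∩ B).card`. -/
def SepOf {G : SimpleGraph V} (H : G.Subgraph) (A B : Finset V) : Prop :=
  (↑A ∪ ↑B : Set V) = H.verts ∧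
    ∀ u v : V, H.Adj u v → ¬(u ∈ A \ B ∧ v ∈ B \ A)

/-- `(A, B)` is a balanced separation of the subgraph `H`:
`|A \ B| ≤ (2/3) |V(H)|` and `|B \ A| ≤ (2/3) |V(H)|`. -/
def BalancedSepOf {G : SimpleGraph V} (H : G.Subgraph) (A B : Finset V) : Prop :=
  SepOf H A B ∧ 3 * (A \ B).card ≤ 2 * H.verts.ncard ∧ 3 * (B \ A).card ≤ 2 * H.verts.ncard

/-- The separation number of `G`: the smallest `s` such that every subgraph of `G`
has a balanced separation of order at most `s`. -/
noncomputable def sepNum (G : SimpleGraph V) : ℕ :=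
  sInf {s | ∀ H : G.Subgraph, ∃ A B : Finset V, BalancedSepOf H A B ∧ (A ∩ B).card ≤ s}

/-- `(A, B)` is a g-separation of `G`: a pair of subgraphs with `A ∪ B = G` and
`E(A) ∩ E(B) = ∅`.  Its order is `(A.verts ∩ B.verts).ncard`. -/
def IsGSep (G : SimpleGraph V) (A B : G.Subgraph) : Prop :=
  A ⊔ B = ⊤ ∧ A.edgeSet ∩ B.edgeSet = ∅

/-- `T` is a tangle of order `θ ≥ 1` in `G`. -/
def IsTangle (G : SimpleGraph V) (T : Set (G.Subgraph × G.Subgraph)) (θ : ℕ) : Prop :=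
  1 ≤ θ ∧
  (∀ p ∈ T, IsGSep G p.1 p.2) ∧
  (∀ A B : G.Subgraph, IsGSep G A B → (A.verts ∩ B.verts).ncard < θ →
    (A, B) ∈ T ∨ (B, A) ∈ T) ∧
  (∀ p₁ ∈ T, ∀ p₂ ∈ T, ∀ p₃ ∈ T, p₁.1 ⊔ p₂.1 ⊔ p₃.1 ≠ (⊤ : G.Subgraph)) ∧
  (∀ p ∈ T, p.1.verts ≠ Set.univ)

/-- The tangle number of `G`: the maximum order of a tangle in `G` (`0` if `G` has
no tangle). -/
noncomputable def tangleNum (G : SimpleGraph V) : ℕ :=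
  sSup {θ | ∃ T, IsTangle G T θ}

/-- Vertex version of a g-separation: `A` and `B` cover all vertices and all edges of `G`. -/
def IsVertexSep (G : SimpleGraph V) (A B : Finset V) : Prop :=
  (∀ v, v ∈ A ∨ v ∈ B) ∧ ∀ u v, G.Adj u v → (u ∈ A ∧ v ∈ A) ∨ (u ∈ B ∧ v ∈ B)

/-- A tangle of order `θ`, described by the pairs of vertex sets whose first side is small. -/
structure IsVertexTangle (G : SimpleGraph V) (small : Finset V → Finset V → Prop) (θ : ℕ) :
    Prop where
  sep : ∀ {A B}, small A B → IsVertexSep G A B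
  total : ∀ {A B}, IsVertexSep G A B → (A ∩ B).card < θ → small A B ∨ small B A
  not_cover : ∀ {A₁ B₁ A₂ B₂ A₃ B₃}, small A₁ B₁ → small A₂ B₂ → small A₃ B₃ →
    (∀ v, v ∈ A₁ ∨ v ∈ A₂ ∨ v ∈ A₃) →
    ¬ ∀ u v, G.Adj u v → (u ∈ A₁ ∧ v ∈ A₁) ∨ (u ∈ A₂ ∧ v ∈ A₂) ∨ (u ∈ A₃ ∧ v ∈ A₃)
  ne_univ : ∀ {A B}, small A B → A ≠ univ

/-- The g-separation on `A` and `B` that puts the edges inside `A ∩ B` on the side of `A`. -/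
def inducedGSep (G : SimpleGraph V) (A B : Finset V) : G.Subgraph × G.Subgraph :=
  ((⊤ : G.Subgraph).induce A,
    ((⊤ : G.Subgraph).induce B).deleteEdges ((⊤ : G.Subgraph).induce A).edgeSet)

omit [Fintype V] [DecidableEq V] in
lemma isGSep_inducedGSep {G : SimpleGraph V} {A B : Finset V} (h : IsVertexSep G A B) :
    IsGSep G (inducedGSep G A B).1 (inducedGSep G A B).2 := by
  obtain ⟨hv, he⟩ := h
  constructor
  · ext u v
    · simpa [inducedGSep] using hv u
    · simp only [inducedGSep, SimpleGraph.Subgraph.sup_adj, SimpleGraph.Subgraph.induce_adj,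
        SimpleGraph.Subgraph.top_adj, SimpleGraph.Subgraph.deleteEdges_adj,
        SimpleGraph.Subgraph.mem_edgeSet, Finset.mem_coe]
      have := he u v
      tauto
  · ext e
    induction e with | _ u v => simp +contextual [inducedGSep]

omit [Fintype V] in
lemma ncard_inter_inducedGSep (G : SimpleGraph V) (A B : Finset V) :
    ((inducedGSep G A B).1.verts ∩ (inducedGSep G A B).2.verts).ncard = (A ∩ B).card := by
  simp only [inducedGSep, SimpleGraph.Subgraph.induce_verts,
    SimpleGraph.Subgraph.deleteEdges_verts]
  rw [← Finset.coe_inter, Set.ncard_coe_finset]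

lemma IsTangle.inducedGSep_mem_or {G : SimpleGraph V} {T : Set (G.Subgraph × G.Subgraph)} {θ : ℕ}
    (hT : IsTangle G T θ) {A B : Finset V} (h : IsVertexSep G A B) (hθ : (A ∩ B).card < θ) :
    inducedGSep G A B ∈ T ∨ inducedGSep G B A ∈ T := by
  obtain ⟨-, -, htot, hcov, huniv⟩ := hT
  have key : ∀ {A B : Finset V}, IsVertexSep G A B → (A ∩ B).card < θ →
      inducedGSep G A B ∈ T ∨ (inducedGSep G A B).swap ∈ T := fun h h' ↦
    htot _ _ (isGSep_inducedGSep h) ((ncard_inter_inducedGSep G _ _).trans_lt h')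
  have h' : IsVertexSep G B A :=
    ⟨fun v ↦ (h.1 v).symm, fun u v huv ↦ (h.2 u v huv).symm⟩
  have hC : IsVertexSep G (A ∩ B) univ := ⟨by simp, by simp⟩
  rcases key h hθ with hAB | hAB
  · exact .inl hAB
  rcases key h' (by rwa [inter_comm]) with hBA | hBA
  · exact .inr hBA
  rcases key hC (by simpa using hθ) with hC | hC
  · refine absurd ?_ (hcov _ hAB _ hBA _ hC)
    ext u v
    · have := h.1 u
      simp only [inducedGSep, Prod.swap, SimpleGraph.Subgraph.verts_sup, Set.mem_union,
        SimpleGraph.Subgraph.induce_verts, SimpleGraph.Subgraph.deleteEdges_verts,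
        SimpleGraph.Subgraph.verts_top, Set.mem_univ, Finset.mem_coe]
      tauto
    · simp only [inducedGSep, Prod.swap, SimpleGraph.Subgraph.sup_adj,
        SimpleGraph.Subgraph.induce_adj, SimpleGraph.Subgraph.top_adj,
        SimpleGraph.Subgraph.deleteEdges_adj, SimpleGraph.Subgraph.mem_edgeSet, Finset.mem_coe,
        mem_inter]
      have := h.2 u v
      tauto
  · exact absurd (by simp [inducedGSep]) (huniv _ hC)

lemma IsTangle.isVertexTangle {G : SimpleGraph V} {T : Set (G.Subgraph × G.Subgraph)} {θ : ℕ}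
    (hT : IsTangle G T θ) :
    IsVertexTangle G (fun A B ↦ IsVertexSep G A B ∧ inducedGSep G A B ∈ T) θ where
  sep h := h.1
  total h hθ := (hT.inducedGSep_mem_or h hθ).imp (⟨h, ·⟩)
    (⟨⟨fun v ↦ (h.1 v).symm, fun u v huv ↦ (h.2 u v huv).symm⟩, ·⟩)
  not_cover {A₁ B₁ A₂ B₂ A₃ B₃} h₁ h₂ h₃ hv he := by
    refine hT.2.2.2.1 _ h₁.2 _ h₂.2 _ h₃.2 ?_
    ext u v
    · simpa [inducedGSep, or_assoc] using hv u
    · simp only [inducedGSep, SimpleGraph.Subgraph.sup_adj, SimpleGraph.Subgraph.induce_adj,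
        SimpleGraph.Subgraph.top_adj, Finset.mem_coe]
      have := he u v
      tauto
  ne_univ {A B} h hA := hT.2.2.2.2 _ h.2 (by simp [inducedGSep, hA])

/-- Every `G[S]` has a balanced separation of order at most `a`. -/
def HasBalancedSeps (G : SimpleGraph V) (a : ℕ) : Prop :=
  ∀ S : Finset V, ∃ X Y : Finset V, X ∪ Y = S ∧
    (∀ u ∈ S, ∀ v ∈ S, G.Adj u v → (u ∈ X ∧ v ∈ X) ∨ (u ∈ Y ∧ v ∈ Y)) ∧
    3 * (X \ Y).card ≤ 2 * S.card ∧ 3 * (Y \ X).card ≤ 2 * S.card ∧ (X ∩ Y).card ≤ a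

omit [Fintype V] in
lemma hasBalancedSeps_of_subgraph {G : SimpleGraph V} {a : ℕ}
    (h : ∀ H : G.Subgraph, ∃ A B : Finset V, BalancedSepOf H A B ∧ (A ∩ B).card ≤ a) :
    HasBalancedSeps G a := by
  intro S
  obtain ⟨X, Y, ⟨⟨hv, he⟩, hX, hY⟩, ha⟩ := h ((⊤ : G.Subgraph).induce S)
  simp only [SimpleGraph.Subgraph.induce_verts, Set.ncard_coe_finset] at hX hY hv
  have hv : X ∪ Y = S := by exact_mod_cast hv
  refine ⟨X, Y, hv, fun u hu v hv' huv ↦ ?_, hX, hY, ha⟩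
  have h₁ := he u v (by simp [hu, hv', huv])
  have h₂ := he v u (by simp [hu, hv', huv.symm])
  subst hv
  simp only [mem_union, mem_sdiff] at *
  tauto

open Classical in
/-- The vertices of `X` that lie in `W` or have a neighbour in `A \ X`. -/
noncomputable def innerBoundary (G : SimpleGraph V) (W A X : Finset V) : Finset V :=
  X.filter fun u ↦ u ∈ W ∨ ∃ v ∈ A \ X, G.Adj u v

/-- Every `X ⊆ A` has at most `L` vertices for each vertex in its boundary. -/
def IsExpanding (G : SimpleGraph V) (W : Finset V) (L : ℕ) (A : Finset V) : Prop :=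
  ∀ X ⊆ A, X.card ≤ L * (innerBoundary G W A X).card

omit [Fintype V] in
lemma mem_innerBoundary {G : SimpleGraph V} {W A X : Finset V} {u : V} :
    u ∈ innerBoundary G W A X ↔ u ∈ X ∧ (u ∈ W ∨ ∃ v, (v ∈ A ∧ v ∉ X) ∧ G.Adj u v) := by
  simp [innerBoundary]

omit [Fintype V] in
lemma card_innerBoundary_union_add_inter (G : SimpleGraph V) (W A X Y : Finset V) :
    (innerBoundary G W A (X ∪ Y)).card + (innerBoundary G W A (X ∩ Y)).card ≤
      (innerBoundary G W A X).card + (innerBoundary G W A Y).card := by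
  rw [← card_union_add_card_inter, ← card_union_add_card_inter (innerBoundary G W A X)]
  have h₁ : innerBoundary G W A (X ∪ Y) ∪ innerBoundary G W A (X ∩ Y) ⊆
      innerBoundary G W A X ∪ innerBoundary G W A Y := by
    intro u
    simp only [mem_union, mem_inter, mem_innerBoundary]
    grind
  have h₂ : innerBoundary G W A (X ∪ Y) ∩ innerBoundary G W A (X ∩ Y) ⊆
      innerBoundary G W A X ∩ innerBoundary G W A Y := by
    intro u
    simp only [mem_union, mem_inter, mem_innerBoundary]
    grind
  exact Nat.add_le_add (card_le_card h₁) (card_le_card h₂)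

omit [Fintype V] in
lemma IsExpanding.union_tight {G : SimpleGraph V} {W : Finset V} {L : ℕ} {A X Y : Finset V}
    (hA : IsExpanding G W L A) (hXA : X ⊆ A)
    (hX : L * (innerBoundary G W A X).card ≤ X.card)
    (hY : L * (innerBoundary G W A Y).card ≤ Y.card) :
    L * (innerBoundary G W A (X ∪ Y)).card ≤ (X ∪ Y).card := by
  have h₁ := Nat.mul_le_mul_left L (card_innerBoundary_union_add_inter G W A X Y)
  have h₂ := hA (X ∩ Y) (inter_subset_left.trans hXA)
  have h₃ := card_union_add_card_inter X Y
  rw [mul_add, mul_add] at h₁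
  omega

omit [Fintype V] in
/-- If an expanding set cannot be extended by `v`, then a tight set absorbs the neighbours
of `v`. -/
lemma IsExpanding.exists_tight_of_not_insert {G : SimpleGraph V} {W : Finset V} {L : ℕ}
    (hL : 1 ≤ L) {A : Finset V} {v : V} (hA : IsExpanding G W L A) (hv : v ∉ A)
    (hins : ¬ IsExpanding G W L (insert v A)) :
    v ∉ W ∧ ∃ X ⊆ A, L * (innerBoundary G W A X).card ≤ X.card ∧ ∀ u ∈ A, G.Adj v u → u ∈ X := by
  simp only [IsExpanding, not_forall, not_le] at hins
  obtain ⟨X, hXA, hX⟩ := hins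
  have hXA' : X.erase v ⊆ A := fun u hu ↦ by
    have := hXA (mem_of_mem_erase hu)
    grind
  have hmono : innerBoundary G W A (X.erase v) ⊆ innerBoundary G W (insert v A) X := by
    intro u
    simp only [mem_innerBoundary]
    grind
  have hcard := hA _ hXA'
  have hvX : v ∈ X := by
    by_contra hvX
    rw [erase_eq_of_notMem hvX] at hcard hmono
    exact absurd (hcard.trans (Nat.mul_le_mul_left L (card_le_card hmono))) (by omega)
  have hXc : X.card = (X.erase v).card + 1 := (card_erase_add_one hvX).symm
  have hvb : v ∉ innerBoundary G W (insert v A) X := by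
    intro hvb
    have hss : insert v (innerBoundary G W A (X.erase v)) ⊆
        innerBoundary G W (insert v A) X := insert_subset hvb hmono
    have h₁ := card_le_card hss
    rw [card_insert_of_notMem (by simp [mem_innerBoundary])] at h₁
    have h₂ := Nat.mul_le_mul_left L h₁
    rw [mul_add] at h₂
    omega
  rw [mem_innerBoundary] at hvb
  refine ⟨fun h ↦ hvb ⟨hvX, .inl h⟩, X.erase v, hXA', ?_, fun u hu huv ↦ ?_⟩
  · have := Nat.mul_le_mul_left L (card_le_card hmono)
    omega
  · by_contra hu'
    have hne : u ≠ v := fun h ↦ hv (h ▸ hu)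
    exact hvb ⟨hvX, .inr ⟨u, ⟨by simp [hu], fun h ↦ hu' (by simp [hne, h])⟩, huv⟩⟩

omit [Fintype V] in
/-- If no cheap cut separates `A` from `W`, then `A` contains an expanding set of size `N`. -/
lemma exists_isExpanding_card_eq (G : SimpleGraph V) (W A : Finset V) {L N : ℕ} (hL : 1 ≤ L)
    (hcut : ∀ X ⊆ A, N ≤ (A \ X).card + L * (innerBoundary G W A X).card) :
    ∃ D ⊆ A, D.card = N ∧ IsExpanding G W L D := by
  classical
  obtain ⟨D, hD, hmax⟩ := exists_max_image
    (A.powerset.filter fun D ↦ D.card ≤ N ∧ IsExpanding G W L D) card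
    ⟨∅, mem_filter.2 ⟨empty_mem_powerset A, by simp, fun X hX ↦ by simp [subset_empty.1 hX]⟩⟩
  simp only [mem_filter, mem_powerset] at hD hmax
  obtain ⟨hDA, hDN, hexp⟩ := hD
  refine ⟨D, hDA, hDN.antisymm ?_, hexp⟩
  by_contra! hlt
  obtain ⟨Z, hZ, hZmax⟩ := exists_max_image
    (D.powerset.filter fun X ↦ L * (innerBoundary G W D X).card ≤ X.card) card
    ⟨∅, by simp [innerBoundary]⟩
  simp only [mem_filter, mem_powerset] at hZ hZmax
  obtain ⟨hZD, hZt⟩ := hZ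
  have hout : ∀ v ∈ A, v ∉ D → v ∉ W ∧ ∀ u ∈ D, G.Adj v u → u ∈ Z := by
    intro v hvA hvD
    have hins : ¬ IsExpanding G W L (insert v D) := fun h ↦ by
      have := hmax (insert v D)
        ⟨insert_subset hvA hDA, by rw [card_insert_of_notMem hvD]; omega, h⟩
      rw [card_insert_of_notMem hvD] at this
      omega
    obtain ⟨hvW, X, hXD, hXt, hX⟩ := hexp.exists_tight_of_not_insert hL hvD hins
    refine ⟨hvW, fun u hu huv ↦ ?_⟩
    have hle := hZmax (Z ∪ X) ⟨union_subset hZD hXD, hexp.union_tight hZD hZt hXt⟩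
    rw [eq_of_subset_of_card_le subset_union_left hle]
    exact mem_union_right _ (hX u hu huv)
  have hsub : innerBoundary G W A (A \ (D \ Z)) ⊆ innerBoundary G W D Z := by
    intro u
    simp only [mem_innerBoundary, mem_sdiff]
    rintro ⟨⟨huA, hu⟩, hu'⟩
    have h := hout u huA
    have huZ : u ∈ Z := by
      by_contra huZ
      have huD : u ∉ D := fun huD ↦ hu ⟨huD, huZ⟩
      rcases hu' with huW | ⟨v, hv, huv⟩
      · exact (h huD).1 huW
      · have := (h huD).2 v
        tauto
    refine ⟨huZ, hu'.imp_right ?_⟩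
    rintro ⟨v, hv, huv⟩
    exact ⟨v, by tauto, huv⟩
  have h₁ := hcut (A \ (D \ Z)) sdiff_subset
  have h₂ := Nat.mul_le_mul_left L (card_le_card hsub)
  have h₃ : A \ (A \ (D \ Z)) = D \ Z := by
    rw [Finset.sdiff_sdiff_eq_self (sdiff_subset.trans hDA)]
  have h₄ := card_sdiff_add_card_eq_card hZD
  rw [h₃] at h₁
  omega

namespace IsVertexTangle

variable {G : SimpleGraph V} {small : Finset V → Finset V → Prop} {θ : ℕ}

lemma small_empty_univ (h : IsVertexTangle G small θ) (hθ : 1 ≤ θ) : small ∅ univ :=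
  (h.total (A := ∅) (B := univ) ⟨by simp, by simp⟩ (by simpa using Nat.pos_of_ne_zero (by omega))).resolve_right
    fun h' ↦ h.ne_univ h' rfl

lemma le_card (h : IsVertexTangle G small θ) {A B : Finset V} (hAB : small A B) :
    θ ≤ B.card := by
  by_contra! hlt
  have hB : small B univ := (h.total ⟨by simp, by simp⟩ (by simpa using hlt)).resolve_right
    fun h' ↦ h.ne_univ h' rfl
  have hs := h.sep hAB
  exact h.not_cover hAB hB hB (fun v ↦ by have := hs.1 v; tauto)
    fun u v huv ↦ by have := hs.2 u v huv; tauto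

lemma card_compl_pos (h : IsVertexTangle G small θ) {A B : Finset V} (hAB : small A B) :
    0 < Aᶜ.card := by
  rw [card_pos, nonempty_iff_ne_empty, Ne, compl_eq_empty_iff]
  exact h.ne_univ hAB

lemma card_eq (h : IsVertexTangle G small θ) {A B : Finset V} (hAB : small A B) :
    B.card = Aᶜ.card + (A ∩ B).card := by
  have : Aᶜ = B \ A := by
    ext v
    have := (h.sep hAB).1 v
    simp only [mem_compl, mem_sdiff]
    tauto
  rw [this, inter_comm, card_sdiff_add_card_inter]

/-- A separation of the large side can be merged into the small side in one of two ways. -/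
lemma small_union_or (h : IsVertexTangle G small θ) {A B X Y : Finset V} (hAB : small A B)
    (hXY : X ∪ Y = B)
    (he : ∀ u ∈ B, ∀ v ∈ B, G.Adj u v → (u ∈ X ∧ v ∈ X) ∨ (u ∈ Y ∧ v ∈ Y))
    (hθ : (A ∩ B).card + (X ∩ Y).card < θ) :
    small (A ∪ X) Y ∨ small (A ∪ Y) X := by
  obtain ⟨hv, hAe⟩ := h.sep hAB
  subst hXY
  have key : ∀ u v, G.Adj u v → (u ∈ A ∧ v ∈ A) ∨ (u ∈ X ∧ v ∈ X) ∨ (u ∈ Y ∧ v ∈ Y) :=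
    fun u v huv ↦ (hAe u v huv).imp_right fun h' ↦ he u h'.1 v h'.2 huv
  simp only [mem_union] at hv
  have h₁ := h.total (A := A ∪ X) (B := Y)
    ⟨fun v ↦ by have := hv v; grind, fun u v huv ↦ by have := key u v huv; grind⟩
    ((card_le_card (by grind)).trans (card_union_le (A ∩ (X ∪ Y)) (X ∩ Y)) |>.trans_lt hθ)
  have h₂ := h.total (A := A ∪ Y) (B := X)
    ⟨fun v ↦ by have := hv v; grind, fun u v huv ↦ by have := key u v huv; grind⟩
    ((card_le_card (by grind)).trans (card_union_le (A ∩ (X ∪ Y)) (X ∩ Y)) |>.trans_lt hθ)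
  rcases h₁ with h₁ | h₁
  · exact .inl h₁
  rcases h₂ with h₂ | h₂
  · exact .inr h₂
  exact absurd key (h.not_cover hAB h₂ h₁ hv)

/-- A set `X` in the small side yields a smaller small side, cut off at the boundary of `X`. -/
lemma small_of_subset (h : IsVertexTangle G small θ) {A B X : Finset V} (hAB : small A B)
    (hX : X ⊆ A) (hθ : (innerBoundary G (A ∩ B) A X).card < θ) :
    small X (Xᶜ ∪ innerBoundary G (A ∩ B) A X) ∧
      X ∩ (Xᶜ ∪ innerBoundary G (A ∩ B) A X) = innerBoundary G (A ∩ B) A X := by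
  obtain ⟨hv, hAe⟩ := h.sep hAB
  have hmem := fun u ↦ mem_innerBoundary (G := G) (W := A ∩ B) (A := A) (X := X) (u := u)
  set S := innerBoundary G (A ∩ B) A X
  have hS : X ∩ (Xᶜ ∪ S) = S := by
    ext u
    simp only [mem_inter, mem_union, mem_compl]
    have := hmem u
    tauto
  have hcross : ∀ u v, G.Adj u v → u ∈ X → v ∉ X → u ∈ S := by
    intro u v huv hu hv'
    have := hAe u v huv
    have := hX hu
    grind
  have hsep : IsVertexSep G X (Xᶜ ∪ S) := by
    refine ⟨fun v ↦ by simp only [mem_union, mem_compl]; tauto, fun u v huv ↦ ?_⟩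
    have := hcross u v huv
    have := hcross v u huv.symm
    simp only [mem_union, mem_compl]
    tauto
  refine ⟨(h.total hsep (by rwa [hS])).resolve_right fun h' ↦ ?_, hS⟩
  refine h.not_cover hAB h' h' (fun v ↦ ?_) fun u v huv ↦ ?_
  · have := hsep.1 v
    have := @hX v
    tauto
  · have := hsep.2 u v huv
    have := @hX u
    have := @hX v
    tauto

/-- A balanced separation of the part outside the small side reduces this part by a third. -/
lemma exists_small_of_balanced (h : IsVertexTangle G small θ) {a : ℕ} (hG : HasBalancedSeps G a)
    {A B : Finset V} (hAB : small A B) (hθ : (A ∩ B).card + ((A ∩ B).card + a) < θ) :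
    ∃ A' B', small A' B' ∧ (A' ∩ B').card ≤ (A ∩ B).card + a ∧
      3 * A'ᶜ.card ≤ 2 * Aᶜ.card := by
  obtain ⟨X, Y, hXY, he, hX, hY, ha⟩ := hG Aᶜ
  obtain ⟨hv, hAe⟩ := h.sep hAB
  have hmem : ∀ v, v ∈ X ∨ v ∈ Y ↔ v ∉ A := fun v ↦ by rw [← mem_union, hXY, mem_compl]
  have hcard : ((X ∪ A ∩ B) ∩ (Y ∪ A ∩ B)).card ≤ (A ∩ B).card + a := by
    rw [← inter_union_distrib_right]
    exact (card_union_le _ _).trans (by omega)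
  have hsub₁ : (A ∪ (X ∪ A ∩ B)) ∩ (Y ∪ A ∩ B) ⊆ (X ∪ A ∩ B) ∩ (Y ∪ A ∩ B) := by grind
  have hsub₂ : (A ∪ (Y ∪ A ∩ B)) ∩ (X ∪ A ∩ B) ⊆ (X ∪ A ∩ B) ∩ (Y ∪ A ∩ B) := by grind
  have hcompl₁ : (A ∪ (X ∪ A ∩ B))ᶜ ⊆ Y \ X := by
    intro v
    have := hmem v
    simp only [mem_compl, mem_union, mem_sdiff]
    tauto
  have hcompl₂ : (A ∪ (Y ∪ A ∩ B))ᶜ ⊆ X \ Y := by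
    intro v
    have := hmem v
    simp only [mem_compl, mem_union, mem_sdiff]
    tauto
  rcases h.small_union_or hAB (X := X ∪ A ∩ B) (Y := Y ∪ A ∩ B) (by grind)
    (fun u hu v hv' huv ↦ by
      have h₁ := hAe u v huv
      have h₂ := he u
      have h₃ := hmem u
      have h₄ := hmem v
      simp only [mem_compl, mem_union, mem_inter] at *
      grind) (by omega) with h' | h'
  · exact ⟨_, _, h', (card_le_card hsub₁).trans hcard, by
      have := card_le_card hcompl₁
      omega⟩
  · exact ⟨_, _, h', (card_le_card hsub₂).trans hcard, by
      have := card_le_card hcompl₂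
      omega⟩

/-- Among the small sides of order at most `m`, choose one minimising `|V \ A| * q ^ order`. -/
lemma exists_minimal (h : IsVertexTangle G small θ) (hθ : 1 ≤ θ) (q : ℝ) (m : ℕ) :
    ∃ A B, small A B ∧ (A ∩ B).card ≤ m ∧
      ∀ A' B', small A' B' → (A' ∩ B').card ≤ m →
        (Aᶜ.card : ℝ) * q ^ (A ∩ B).card ≤ A'ᶜ.card * q ^ (A' ∩ B').card := by
  obtain ⟨⟨A, B⟩, ⟨hAB, hm⟩, hmin⟩ := Set.exists_min_image
    {p : Finset V × Finset V | small p.1 p.2 ∧ (p.1 ∩ p.2).card ≤ m}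
    (fun p ↦ (p.1ᶜ.card : ℝ) * q ^ (p.1 ∩ p.2).card) (Set.toFinite _)
    ⟨(∅, univ), h.small_empty_univ hθ, by simp⟩
  exact ⟨A, B, hAB, hm, fun A' B' h₁ h₂ ↦ hmin (A', B') ⟨h₁, h₂⟩⟩

lemma false_of_hasBalancedSeps {a : ℕ} (h : IsVertexTangle G small (70 * a + 1)) (ha : 1 ≤ a)
    (hG : HasBalancedSeps G a) : False := by
  have ha' : (0 : ℝ) < a := by exact_mod_cast ha
  set x : ℝ := 1 / (4 * a) with hx
  have hx0 : 0 < x := by positivity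
  have hax : a * x = 1 / 4 := by rw [hx]; field_simp
  have hqa : (1 + x) ^ a ≤ 4 / 3 := by
    have hx1 : x ≤ 1 := by
      have : (1 : ℝ) ≤ a := by exact_mod_cast ha
      nlinarith
    have h₁ := one_add_mul_le_pow (a := -x) (by linarith) a
    have h₂ : (1 + x) ^ a * (1 + -x) ^ a ≤ 1 := by
      rw [← mul_pow]
      exact pow_le_one₀ (by nlinarith) (by nlinarith)
    have h₃ : 0 < (1 + x) ^ a := by positivity
    nlinarith
  obtain ⟨A, B, hAB, hw, hmin⟩ := h.exists_minimal (by omega) (1 + x) (21 * a)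
  have hβ := h.card_compl_pos hAB
  have hB := h.card_eq hAB
  have hBθ := h.le_card hAB
  obtain ⟨hv, hAe⟩ := h.sep hAB
  set w := (A ∩ B).card with hw_def
  set β := Aᶜ.card with hβ_def
  have hβ' : (0 : ℝ) < β := by exact_mod_cast hβ
  have hw' : 20 * a < w := by
    by_contra! hle
    obtain ⟨A', B', hAB', hw₁, hβ₁⟩ := h.exists_small_of_balanced hG hAB (by omega)
    have h₁ := hmin A' B' hAB' (by omega)
    have h₂ : (3 : ℝ) * A'ᶜ.card ≤ 2 * β := by exact_mod_cast hβ₁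
    have h₃ : (1 + x) ^ (A' ∩ B').card ≤ (1 + x) ^ w * (1 + x) ^ a := by
      rw [← pow_add]
      exact pow_le_pow_right₀ (by linarith) hw₁
    have h₄ : 0 < (1 + x) ^ w := by positivity
    have h₅ : (A'ᶜ.card : ℝ) * (1 + x) ^ (A' ∩ B').card ≤
        (2 / 3 * β) * ((1 + x) ^ w * (4 / 3)) :=
      mul_le_mul (by linarith) (h₃.trans (by gcongr)) (by positivity) (by positivity)
    nlinarith [mul_pos hβ' h₄]
  set L := β / (4 * a) with hL_def
  have hL₁ : L * (4 * a) ≤ β := Nat.div_mul_le_self _ _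
  have hL₂ : β < (L + 1) * (4 * a) := Nat.lt_mul_of_div_lt (Nat.lt_succ_self _) (by omega)
  have hL : 2 ≤ L := by
    rw [hL_def, Nat.le_div_iff_mul_le (by omega)]
    omega
  obtain ⟨D, hDA, hD, hexp⟩ := exists_isExpanding_card_eq G (A ∩ B) A (L := L) (N := L * w)
    (by omega) (by
      intro X hX
      by_contra! hlt
      have hsw : (innerBoundary G (A ∩ B) A X).card < w :=
        lt_of_mul_lt_mul_left (a := L) (by omega) (Nat.zero_le _)
      obtain ⟨h₁, h₂⟩ := h.small_of_subset hAB hX (by omega)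
      have h₃ := hmin _ _ h₁ (by rw [h₂]; omega)
      rw [h₂] at h₃
      have hcompl : Xᶜ.card = β + (A \ X).card := by
        rw [hβ_def, ← card_union_of_disjoint]
        · congr 1
          ext v
          have := @hX v
          simp only [mem_compl, mem_union, mem_sdiff]
          tauto
        · rw [disjoint_left]
          simp +contextual
      obtain ⟨d, hd⟩ := Nat.exists_eq_add_of_le hsw.le
      set s := (innerBoundary G (A ∩ B) A X).card
      have h₄ : (A \ X).card < L * d := by
        rw [hd, mul_add] at hlt
        omega
      have h₅ : ((A \ X).card : ℝ) < L * d := by exact_mod_cast h₄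
      have h₆ : (L : ℝ) ≤ β * x := by
        have : (L : ℝ) * (4 * a) ≤ β := by exact_mod_cast hL₁
        rw [hx, mul_one_div, le_div_iff₀ (by positivity)]
        exact this
      have h₇ := one_add_mul_le_pow (a := x) (by linarith) d
      rw [hcompl, hd, pow_add] at h₃
      have h₈ : 0 < (1 + x) ^ s := by positivity
      have h₉ : (β : ℝ) * (1 + x) ^ d ≤ β + (A \ X).card := by
        push_cast at h₃
        refine le_of_mul_le_mul_right ?_ h₈
        linarith
      have h₁₀ : (L : ℝ) * d ≤ β * x * d := by gcongr
      nlinarith)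
  have hBD : β + L * w ≤ (B ∪ D).card := by
    rw [hβ_def, ← hD, ← card_union_of_disjoint]
    · refine card_le_card fun v ↦ ?_
      have := hv v
      simp only [mem_compl, mem_union]
      tauto
    · rw [disjoint_left]
      intro v hv₁ hv₂
      exact mem_compl.1 hv₁ (hDA hv₂)
  have key : ∀ X Y : Finset V, X ∪ Y = B ∪ D →
      (∀ u ∈ B ∪ D, ∀ v ∈ B ∪ D, G.Adj u v → (u ∈ X ∧ v ∈ X) ∨ (u ∈ Y ∧ v ∈ Y)) →
      3 * (Y \ X).card ≤ 2 * (B ∪ D).card → (X ∩ Y).card ≤ a →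
      ¬ small (A ∪ X ∩ B) (Y ∩ B) := by
    intro X Y hXY he hY hXYa hs
    have hmem : ∀ v, (v ∈ X ∨ v ∈ Y) ↔ (v ∈ B ∨ v ∈ D) := fun v ↦ by
      rw [← mem_union, hXY, mem_union]
    have hXW : (X ∩ (A ∩ B)).card ≤ a := by
      by_contra! hlt
      have hsub : (A ∪ X ∩ B) ∩ (Y ∩ B) ⊆ ((A ∩ B) \ (X ∩ (A ∩ B))) ∪ X ∩ Y := by
        intro v
        simp only [mem_inter, mem_union, mem_sdiff]
        tauto
      have h₁ := (card_le_card hsub).trans (card_union_le _ _)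
      have h₂ := card_sdiff_add_card_eq_card (s := X ∩ (A ∩ B)) (t := A ∩ B) inter_subset_right
      have h₃ : ((A ∪ X ∩ B) ∩ (Y ∩ B)).card < w := by omega
      have h₄ := hmin _ _ hs (by omega)
      have h₅ : (A ∪ X ∩ B)ᶜ.card ≤ β :=
        card_le_card (compl_subset_compl.2 subset_union_left)
      have h₆ : (1 + x) ^ ((A ∪ X ∩ B) ∩ (Y ∩ B)).card < (1 + x) ^ w :=
        pow_lt_pow_right₀ (by linarith) h₃
      have h₇ : ((A ∪ X ∩ B)ᶜ.card : ℝ) * (1 + x) ^ ((A ∪ X ∩ B) ∩ (Y ∩ B)).card <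
          β * (1 + x) ^ w :=
        mul_lt_mul' (by exact_mod_cast h₅) h₆ (by positivity) hβ'
      linarith
    have hXD : (X ∩ D).card ≤ L * (a + a) := by
      refine (hexp _ inter_subset_right).trans (Nat.mul_le_mul_left L ?_)
      refine (card_le_card (t := X ∩ Y ∪ X ∩ (A ∩ B)) fun u ↦ ?_).trans
        ((card_union_le _ _).trans (Nat.add_le_add hXYa hXW))
      simp only [mem_innerBoundary, mem_union, mem_inter]
      rintro ⟨⟨huX, huD⟩, hu | ⟨v, ⟨hvD, hvX⟩, huv⟩⟩
      · tauto
      · have := he u (mem_union_right _ huD) v (mem_union_right _ hvD) huv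
        tauto
    have hX : X.card ≤ β + a + L * (a + a) := by
      have hsub : X ⊆ Aᶜ ∪ X ∩ (A ∩ B) ∪ X ∩ D := by
        intro v
        have := hmem v
        simp only [mem_compl, mem_union, mem_inter]
        tauto
      have h₁ := card_le_card hsub
      have h₂ := card_union_le (Aᶜ ∪ X ∩ (A ∩ B)) (X ∩ D)
      have h₃ := card_union_le Aᶜ (X ∩ (A ∩ B))
      omega
    have hcard : (B ∪ D).card = (Y \ X).card + X.card := by
      rw [← hXY, union_comm, ← card_sdiff_add_card]
    have hLw : L * (20 * a) ≤ L * w := Nat.mul_le_mul_left L hw'.le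
    have hLa : 2 * a ≤ L * a := Nat.mul_le_mul_right a hL
    nlinarith
  obtain ⟨X, Y, hXY, he, hX, hY, hXYa⟩ := hG (B ∪ D)
  rcases h.small_union_or hAB (X := X ∩ B) (Y := Y ∩ B)
    (by rw [← union_inter_distrib_right, hXY]; simp)
    (fun u hu v hv' huv ↦ by
      have := he u (mem_union_left _ hu) v (mem_union_left _ hv') huv
      simp only [mem_inter]
      tauto)
    (by
      have := card_le_card (show X ∩ B ∩ (Y ∩ B) ⊆ X ∩ Y by grind)
      omega) with h' | h'
  · exact key X Y hXY he hY hXYa h'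
  · exact key Y X (by rw [union_comm, hXY]) (fun u hu v hv' huv ↦ (he u hu v hv' huv).symm) hX
      (by rwa [inter_comm]) h'

end IsVertexTangle

lemma sepNum_spec (G : SimpleGraph V) (H : G.Subgraph) :
    ∃ A B : Finset V, BalancedSepOf H A B ∧ (A ∩ B).card ≤ sepNum G := by
  classical
  refine Nat.sInf_mem (s := {s | ∀ H : G.Subgraph, ∃ A B : Finset V,
    BalancedSepOf H A B ∧ (A ∩ B).card ≤ s}) ⟨Fintype.card V, fun H ↦ ?_⟩ H
  exact ⟨H.verts.toFinset, H.verts.toFinset, by simp [BalancedSepOf, SepOf], card_le_univ _⟩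

lemma one_le_sepNum (G : SimpleGraph V) (v : V) : 1 ≤ sepNum G := by
  obtain ⟨X, Y, hXY, -, hX, hY, ha⟩ := hasBalancedSeps_of_subgraph (sepNum_spec G) {v}
  have h₁ := card_sdiff_add_card_inter Y X
  have h₂ := card_sdiff_add_card X Y
  rw [hXY] at h₂
  rw [card_singleton] at h₂ hX hY
  rw [inter_comm] at h₁
  omega

omit [Fintype V] [DecidableEq V] in
lemma IsTangle.nonempty {G : SimpleGraph V} {T : Set (G.Subgraph × G.Subgraph)} {θ : ℕ}
    (hT : IsTangle G T θ) : Nonempty V := by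
  by_contra hV
  rw [not_nonempty_iff] at hV
  obtain ⟨hθ, -, htot, -, huniv⟩ := hT
  rcases htot ⊤ ⊥ ⟨by simp, by simp⟩ (by simpa using Nat.pos_of_ne_zero (by omega)) with h | h <;>
    exact huniv _ h (Subsingleton.elim _ _)

omit [Fintype V] [DecidableEq V] in
lemma IsTangle.mono {G : SimpleGraph V} {T : Set (G.Subgraph × G.Subgraph)} {θ θ' : ℕ}
    (hT : IsTangle G T θ) (h₁ : 1 ≤ θ') (h₂ : θ' ≤ θ) : IsTangle G T θ' :=
  ⟨h₁, hT.2.1, fun A B hAB h ↦ hT.2.2.1 A B hAB (h.trans_le h₂), hT.2.2.2⟩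

/-- The tangle number of a finite graph is at most 70 times its separation number;
equivalently, if `a ≥ 1` and every subgraph of `G` has a balanced separation of order
at most `a`, then `G` contains no tangle of order `70a + 1`. -/
theorem tangleNum_le_70_mul_sepNum (G : SimpleGraph V) :
    tangleNum G ≤ 70 * sepNum G ∧
      ∀ a : ℕ, 1 ≤ a →
        (∀ H : G.Subgraph, ∃ A B : Finset V, BalancedSepOf H A B ∧ (A ∩ B).card ≤ a) →
        ¬ ∃ T : Set (G.Subgraph × G.Subgraph), IsTangle G T (70 * a + 1) := by
  have main : ∀ a : ℕ, 1 ≤ a →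
      (∀ H : G.Subgraph, ∃ A B : Finset V, BalancedSepOf H A B ∧ (A ∩ B).card ≤ a) →
      ¬ ∃ T : Set (G.Subgraph × G.Subgraph), IsTangle G T (70 * a + 1) :=
    fun a ha h ⟨_, hT⟩ ↦
      hT.isVertexTangle.false_of_hasBalancedSeps ha (hasBalancedSeps_of_subgraph h)
  refine ⟨?_, main⟩
  have hsep := sepNum_spec G
  refine csSup_le' ?_
  rintro θ ⟨T, hT⟩
  by_contra! hlt
  obtain ⟨v⟩ := hT.nonempty
  exact main _ (one_le_sepNum G v) hsep ⟨T, hT.mono (by omega) hlt⟩
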